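/- Let (Σ,σ) be a topologically transitive countable Markov shift with the F-property and φ : Σ → ℝ a potential with summable variations and Gurevich pressure P(φ) = 0. Then there is no q ∈ ℕ and sequence (x^k)_{k≥1} of periodic points of periods p_k such that (1/p_k)S_{p_k}φ(x^k) → 0 and ν_k([≤q]) → 1 as k → ∞, where ν_k := (1/p_k)Σ_{i=0}^{p_k−1} δ_{σ^i x^k} is the periodic orbit measure and [≤q] := ∪_{a≤q}[a]. -/

import Mathlib

open Filter Set MeasureTheory Real ENNReal

namespace CMS

/-- Points of the full sequence space over the alphabet `ℕ`. -/
abbrev Pt : Type := ℕ → ℕ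

/-- The (left) shift map `σ`. -/
def shiftMap : Pt → Pt := fun x i => x (i + 1)

/-- `x` is a point of the countable Markov shift `Σ` determined by the
transition matrix `M` (identified with a relation on the alphabet `ℕ`). -/
def isAdmissible (M : ℕ → ℕ → Prop) (x : Pt) : Prop := ∀ i, M (x i) (x (i + 1))

/-- Topological transitivity: for all states `a, b` there is `N` with
`[a] ∩ σ⁻ᴺ [b] ≠ ∅`. -/
def TopTransitive (M : ℕ → ℕ → Prop) : Prop :=
  ∀ a b : ℕ, ∃ (N : ℕ) (x : Pt), isAdmissible M x ∧ x 0 = a ∧ x N = b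

/-- Birkhoff sum `S_n φ`. -/
noncomputable def birkhoff (φ : Pt → ℝ) (n : ℕ) (x : Pt) : ℝ :=
  ∑ i ∈ Finset.range n, φ (shiftMap^[i] x)

/-- `φ` has summable variations: `∑_{k ≥ 2} var_k(φ) < ∞`, expressed via a summable
sequence dominating the `k`-th variations. -/
def SummableVariations (M : ℕ → ℕ → Prop) (φ : Pt → ℝ) : Prop :=
  ∃ V : ℕ → ℝ, Summable V ∧
    ∀ k, 2 ≤ k → ∀ x y : Pt, isAdmissible M x → isAdmissible M y →
      (∀ i < k, x i = y i) → |φ x - φ y| ≤ V k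

/-- `φ` is weakly Hölder continuous: `var_k(φ) ≤ C θ^k` for all `k ≥ 2`. -/
def WeaklyHolder (M : ℕ → ℕ → Prop) (φ : Pt → ℝ) : Prop :=
  ∃ C θ : ℝ, 0 < C ∧ 0 < θ ∧ θ < 1 ∧
    ∀ k, 2 ≤ k → ∀ x y : Pt, isAdmissible M x → isAdmissible M y →
      (∀ i < k, x i = y i) → |φ x - φ y| ≤ C * θ ^ k

/-- Periodic points of period `n` in the 1-cylinder `[a]`. -/
def PerSet (M : ℕ → ℕ → Prop) (a n : ℕ) : Set Pt :=
  {x | isAdmissible M x ∧ shiftMap^[n] x = x ∧ x 0 = a}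

/-- Periodic points of period `n` in `[a]` whose first return time to `[a]` is `n`. -/
def PerStarSet (M : ℕ → ℕ → Prop) (a n : ℕ) : Set Pt :=
  {x | isAdmissible M x ∧ shiftMap^[n] x = x ∧ x 0 = a ∧ ∀ k, 0 < k → k < n → x k ≠ a}

/-- The Gurevich partition function `Z_n(φ, a)`. -/
noncomputable def Zn (M : ℕ → ℕ → Prop) (φ : Pt → ℝ) (a n : ℕ) : ℝ≥0∞ :=
  ∑' x : PerSet M a n, ENNReal.ofReal (Real.exp (birkhoff φ n x.1))

/-- The first-return partition function `Z_n^*(φ, a)`. -/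
noncomputable def ZnStar (M : ℕ → ℕ → Prop) (φ : Pt → ℝ) (a n : ℕ) : ℝ≥0∞ :=
  ∑' x : PerStarSet M a n, ENNReal.ofReal (Real.exp (birkhoff φ n x.1))

/-- The Gurevich pressure at the state `a`:
`P(φ) = limsup_n (1/n) log Z_n(φ, a)`, with values in `EReal`. -/
noncomputable def pressureAt (M : ℕ → ℕ → Prop) (φ : Pt → ℝ) (a : ℕ) : EReal :=
  Filter.limsup (fun n : ℕ => ((n : ℝ)⁻¹ : EReal) * ENNReal.log (Zn M φ a n)) atTop

/-- `limsup_n (1/n) log Z_n^*(φ, a)`, with values in `EReal`. -/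
noncomputable def pressureStarAt (M : ℕ → ℕ → Prop) (φ : Pt → ℝ) (a : ℕ) : EReal :=
  Filter.limsup (fun n : ℕ => ((n : ℝ)⁻¹ : EReal) * ENNReal.log (ZnStar M φ a n)) atTop

/-- Strong positive recurrence of `φ`, relative to the common value `P` of the
Gurevich pressure: for some state `a`, `limsup_n (1/n) log Z_n^*(φ,a) < P(φ)`. -/
def SPR (M : ℕ → ℕ → Prop) (φ : Pt → ℝ) (P : ℝ) : Prop :=
  ∃ a : ℕ, pressureStarAt M φ a < (P : EReal)

/-- The `F`-property: for every state `a` and every `n ≥ 1` there are only finitely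
many periodic points of period `n` in `[a]`. -/
def FProperty (M : ℕ → ℕ → Prop) : Prop :=
  ∀ a n : ℕ, 0 < n → (PerSet M a n).Finite

/-- `χ_per(φ) = sup { (1/n) S_n φ(x) : σ^n x = x, n ∈ ℕ }`, with values in `EReal`. -/
noncomputable def chiPer (M : ℕ → ℕ → Prop) (φ : Pt → ℝ) : EReal :=
  ⨆ p : {p : Pt × ℕ // isAdmissible M p.1 ∧ 0 < p.2 ∧ shiftMap^[p.2] p.1 = p.1},
    ((birkhoff φ p.1.2 p.1.1 / (p.1.2 : ℝ) : ℝ) : EReal)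

/-- `x` lies in a cylinder belonging to `B(n, M', q)`: it is admissible,
`x 0 ≤ q`, `x n ≤ q` and `#{0 ≤ k ≤ n : x k ≤ q} ≤ (n+1)/M'`. -/
def inBSet (M : ℕ → ℕ → Prop) (n M' q : ℕ) (x : Pt) : Prop :=
  isAdmissible M x ∧ x 0 ≤ q ∧ x n ≤ q ∧
    ((((Finset.range (n + 1)).filter (fun k => x k ≤ q)).card : ℝ) ≤ (n + 1 : ℝ) / (M' : ℝ))

/-- `z_{φ,n}(M',q) = sup { (1/n) S_n φ(x) : x ∈ B for some B ∈ B(n,M',q) }`. -/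
noncomputable def zPhi (M : ℕ → ℕ → Prop) (φ : Pt → ℝ) (n M' q : ℕ) : EReal :=
  ⨆ x : {x : Pt // inBSet M n M' q x}, ((birkhoff φ n x.1 / (n : ℝ) : ℝ) : EReal)

/-- The contraction at infinity
`δ_{φ,∞} = lim_{q→∞} lim_{M'→∞} limsup_{n→∞} z_{φ,n}(M',q)`
(the inner limits exist by monotonicity, so they agree with `liminf`s). -/
noncomputable def deltaInf (M : ℕ → ℕ → Prop) (φ : Pt → ℝ) : EReal :=
  liminf (fun q : ℕ => liminf (fun M' : ℕ =>
    limsup (fun n : ℕ => zPhi M φ n M' q) atTop) atTop) atTop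

/-- `z_n(M',q) = #B(n,M',q)`, the number of `(n+1)`-cylinders (i.e. admissible
words realized in `Σ`) in `B(n,M',q)`, counted in `ℝ≥0∞`. -/
noncomputable def zCount (M : ℕ → ℕ → Prop) (n M' q : ℕ) : ℝ≥0∞ :=
  ∑' _w : {w : Fin (n + 1) → ℕ //
      (∃ x : Pt, isAdmissible M x ∧ ∀ i : Fin (n + 1), x (i : ℕ) = w i) ∧
      w 0 ≤ q ∧ w (Fin.last n) ≤ q ∧
      (((Finset.univ.filter (fun i : Fin (n + 1) => w i ≤ q)).card : ℝ) ≤ (n + 1 : ℝ) / (M' : ℝ))},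
    (1 : ℝ≥0∞)

/-- The entropy at infinity
`h_∞ = lim_{q→∞} lim_{M'→∞} limsup_{n→∞} (1/n) log z_n(M',q)`. -/
noncomputable def hInfty (M : ℕ → ℕ → Prop) : EReal :=
  liminf (fun q : ℕ => liminf (fun M' : ℕ =>
    limsup (fun n : ℕ => ((n : ℝ)⁻¹ : EReal) * ENNReal.log (zCount M n M' q)) atTop) atTop) atTop

end CMS

open CMS

namespace CMS

lemma shiftMap_iterate_apply (n : ℕ) (x : Pt) (i : ℕ) : shiftMap^[n] x i = x (i + n) := by
  induction n generalizing x with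
  | zero => rfl
  | succ n ih =>
    rw [Function.iterate_succ_apply, ih]
    simp only [shiftMap]
    rw [add_assoc]

lemma isAdmissible.shift {M : ℕ → ℕ → Prop} {x : Pt} (hx : isAdmissible M x) (n : ℕ) :
    isAdmissible M (shiftMap^[n] x) := by
  intro i
  simp only [shiftMap_iterate_apply]
  rw [show i + 1 + n = i + n + 1 by ring]
  exact hx _

lemma birkhoff_add (φ : Pt → ℝ) (m n : ℕ) (x : Pt) :
    birkhoff φ (m + n) x = birkhoff φ m x + birkhoff φ n (shiftMap^[m] x) := by
  simp only [birkhoff]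
  rw [Finset.sum_range_add]
  refine congrArg _ (Finset.sum_congr rfl fun i _ => ?_)
  rw [← Function.iterate_add_apply, add_comm]

lemma birkhoff_mul_of_periodic (φ : Pt → ℝ) {p : ℕ} {x : Pt} (hx : shiftMap^[p] x = x) (j : ℕ) :
    birkhoff φ (j * p) x = j * birkhoff φ p x := by
  induction j with
  | zero => simp [birkhoff]
  | succ j ih =>
    rw [add_mul, one_mul, add_comm, birkhoff_add, hx, ih]
    push_cast
    ring

/-- Birkhoff sums of length `n` along admissible points agreeing on `n + 1` coordinates differ by
at most `C`. -/
def BoundedDistortion (M : ℕ → ℕ → Prop) (φ : Pt → ℝ) (C : ℝ) : Prop :=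
  ∀ (n : ℕ) (x y : Pt), isAdmissible M x → isAdmissible M y → (∀ i ≤ n, x i = y i) →
    birkhoff φ n x ≤ birkhoff φ n y + C

lemma SummableVariations.exists_boundedDistortion {M : ℕ → ℕ → Prop} {φ : Pt → ℝ}
    (h : SummableVariations M φ) : ∃ C, 0 ≤ C ∧ BoundedDistortion M φ C := by
  obtain ⟨V, hV, hvar⟩ := h
  refine ⟨∑' k, |V k|, tsum_nonneg fun _ => abs_nonneg _, fun n x y hx hy hxy => ?_⟩
  have hterm : ∀ i ∈ Finset.range n,
      φ (shiftMap^[i] x) ≤ φ (shiftMap^[i] y) + |V (n - 1 - i + 2)| := by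
    intro i hi
    rw [Finset.mem_range] at hi
    have := hvar (n - 1 - i + 2) (by omega) _ _ (hx.shift i) (hy.shift i) (fun k hk => by
      simp only [shiftMap_iterate_apply]
      exact hxy _ (by omega))
    linarith [le_abs_self (φ (shiftMap^[i] x) - φ (shiftMap^[i] y)),
      le_abs_self (V (n - 1 - i + 2))]
  have hsum := Finset.sum_le_sum hterm
  rw [Finset.sum_add_distrib, Finset.sum_range_reflect (fun j => |V (j + 2)|)] at hsum
  have htail : ∑ j ∈ Finset.range n, |V (j + 2)| ≤ ∑' k, |V k| := by
    have := hV.abs.sum_le_tsum ((Finset.range n).map (addRightEmbedding 2))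
      (fun _ _ => abs_nonneg _)
    simpa [Finset.sum_map] using this
  simp only [birkhoff]
  linarith

/-- The point obtained by concatenating the first `n` symbols of each `g k`. -/
def concat (n : ℕ) (g : ℕ → Pt) : Pt := fun i => g (i / n) (i % n)

lemma shiftMap_concat {n : ℕ} (hn : 0 < n) (g : ℕ → Pt) (k : ℕ) :
    shiftMap^[n * k] (concat n g) = concat n fun i => g (i + k) := by
  funext i
  simp [shiftMap_iterate_apply, concat, Nat.add_mul_div_left _ _ hn]

lemma concat_apply {n : ℕ} (hn : 0 < n) {g : ℕ → Pt} {a : ℕ} (h0 : ∀ k, g k 0 = a)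
    (h1 : ∀ k, g k n = a) {i : ℕ} (hi : i ≤ n) : concat n g i = g 0 i := by
  rcases hi.lt_or_eq with hi | rfl
  · simp [concat, Nat.div_eq_of_lt hi, Nat.mod_eq_of_lt hi]
  · simp [concat, Nat.div_self hn, h0, h1]

lemma isAdmissible_concat {M : ℕ → ℕ → Prop} {n : ℕ} (hn : 0 < n) {g : ℕ → Pt} {a : ℕ}
    (hg : ∀ k, isAdmissible M (g k)) (h0 : ∀ k, g k 0 = a) (h1 : ∀ k, g k n = a) :
    isAdmissible M (concat n g) := by
  intro i
  have hi := Nat.mod_lt i hn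
  have h (r : ℕ) (hr : r ≤ n) : concat n g (r + n * (i / n)) = g (i / n) r := by
    rw [← shiftMap_iterate_apply _ (concat n g), shiftMap_concat hn, concat_apply hn (fun _ => h0 _)
      (fun _ => h1 _) hr, zero_add]
  have e := Nat.mod_add_div i n
  have e1 := h (i % n) hi.le
  have e2 := h (i % n + 1) hi
  rw [show i % n + 1 + n * (i / n) = i + 1 by omega] at e2
  rw [e] at e1
  rw [e1, e2]
  exact hg _ _

lemma sum_birkhoff_le_birkhoff_concat {M : ℕ → ℕ → Prop} {φ : Pt → ℝ} {C : ℝ}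
    (hC : BoundedDistortion M φ C) {n : ℕ} (hn : 0 < n) {a : ℕ} (j : ℕ) (g : ℕ → Pt)
    (hg : ∀ k, isAdmissible M (g k)) (h0 : ∀ k, g k 0 = a) (h1 : ∀ k, g k n = a) :
    ∑ k ∈ Finset.range j, (birkhoff φ n (g k) - C) ≤ birkhoff φ (n * j) (concat n g) := by
  induction j generalizing g with
  | zero => simp [birkhoff]
  | succ j ih =>
    have hrest := ih (fun k => g (k + 1)) (fun _ => hg _) (fun _ => h0 _) (fun _ => h1 _)
    have hshift := shiftMap_concat hn g 1
    rw [mul_one] at hshift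
    rw [Finset.sum_range_succ', mul_add, mul_one, add_comm (n * j), birkhoff_add, hshift]
    have hhead := hC n (g 0) (concat n g) (hg 0) (isAdmissible_concat hn hg h0 h1)
      (fun i hi => (concat_apply hn h0 h1 hi).symm)
    linarith

lemma pow_sum_exp_le_Zn {M : ℕ → ℕ → Prop} {φ : Pt → ℝ} {C : ℝ}
    (hC : BoundedDistortion M φ C) {n : ℕ} (hn : 0 < n) {a : ℕ} {ι : Type*} [Fintype ι]
    (w : ι → Pt) (hw : ∀ i, isAdmissible M (w i)) (h0 : ∀ i, w i 0 = a) (h1 : ∀ i, w i n = a)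
    (hinj : ∀ i j, (∀ k < n, w i k = w j k) → i = j) (j : ℕ) [NeZero j] :
    ENNReal.ofReal ((∑ i, exp (birkhoff φ n (w i) - C)) ^ j) ≤ Zn M φ a (n * j) := by
  classical
  let g (f : Fin j → ι) (k : ℕ) : Pt := w (f (Fin.ofNat j k))
  have hper (f : Fin j → ι) : concat n (g f) ∈ PerSet M a (n * j) := by
    refine ⟨isAdmissible_concat hn (fun _ => hw _) (fun _ => h0 _) (fun _ => h1 _), ?_, ?_⟩
    · rw [shiftMap_concat hn]
      congr 1
      funext k
      simp only [g]
      congr 2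
      ext
      simp
    · rw [concat_apply hn (fun _ => h0 _) (fun _ => h1 _) (Nat.zero_le _)]
      exact h0 _
  let F (f : Fin j → ι) : PerSet M a (n * j) := ⟨concat n (g f), hper f⟩
  have hF : Function.Injective F := by
    intro f f' hff
    funext k
    refine hinj _ _ fun r hr => ?_
    have := congrFun (congrArg Subtype.val hff) (r + n * k)
    simpa [F, g, concat, Nat.add_mul_div_left _ _ hn, Nat.div_eq_of_lt hr,
      Nat.mod_eq_of_lt hr] using this
  have hpow : (∑ i, exp (birkhoff φ n (w i) - C)) ^ j
      = ∑ f : Fin j → ι, ∏ k, exp (birkhoff φ n (w (f k)) - C) := by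
    rw [Finset.sum_pow']
    simp
  rw [hpow, ENNReal.ofReal_sum_of_nonneg
    (fun f _ => Finset.prod_nonneg fun _ _ => (exp_pos _).le)]
  calc ∑ f : Fin j → ι, ENNReal.ofReal (∏ k, exp (birkhoff φ n (w (f k)) - C))
      ≤ ∑ f : Fin j → ι, ENNReal.ofReal (exp (birkhoff φ (n * j) (F f).1)) := by
        refine Finset.sum_le_sum fun f _ => ENNReal.ofReal_le_ofReal ?_
        rw [← Real.exp_sum, Real.exp_le_exp]
        have := sum_birkhoff_le_birkhoff_concat hC hn j (g f) (fun _ => hw _) (fun _ => h0 _)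
          (fun _ => h1 _)
        rw [Finset.sum_range] at this
        simpa [g, F] using this
    _ = ∑' f : Fin j → ι, ENNReal.ofReal (exp (birkhoff φ (n * j) (F f).1)) := by
        rw [tsum_fintype]
    _ ≤ Zn M φ a (n * j) :=
        ENNReal.tsum_comp_le_tsum_of_injective hF
          (fun x : PerSet M a (n * j) => ENNReal.ofReal (exp (birkhoff φ (n * j) x.1)))

/-- Distinct return words of the same length at `a` have total weight bounded by the distortion
when the pressure vanishes. -/
lemma sum_exp_birkhoff_le {M : ℕ → ℕ → Prop} {φ : Pt → ℝ} {C : ℝ}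
    (hC : BoundedDistortion M φ C) {a : ℕ} (hP : pressureAt M φ a = 0) {n : ℕ} (hn : 0 < n)
    {ι : Type*} [Fintype ι]
    (w : ι → Pt) (hw : ∀ i, isAdmissible M (w i)) (h0 : ∀ i, w i 0 = a) (h1 : ∀ i, w i n = a)
    (hinj : ∀ i j, (∀ k < n, w i k = w j k) → i = j) :
    ∑ i, exp (birkhoff φ n (w i)) ≤ exp C := by
  have hscale : ∑ i, exp (birkhoff φ n (w i))
      = exp C * ∑ i, exp (birkhoff φ n (w i) - C) := by
    rw [Finset.mul_sum]
    refine Finset.sum_congr rfl fun i _ => ?_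
    rw [← Real.exp_add]
    congr 1
    ring
  rw [hscale]
  refine mul_le_of_le_one_right (exp_pos _).le ?_
  set s := ∑ i, exp (birkhoff φ n (w i) - C) with hs
  by_contra! h
  have hlog : 0 < Real.log s := Real.log_pos h
  have hn' : (0 : ℝ) < n := by exact_mod_cast hn
  have hlim : pressureAt M φ a < ((Real.log s / n : ℝ) : EReal) := by
    rw [hP]
    exact_mod_cast div_pos hlog hn'
  obtain ⟨N, hN⟩ := eventually_atTop.1 (eventually_lt_of_limsup_lt hlim)
  have hlt := hN (n * (N + 1)) (by nlinarith)
  have hZ := ENNReal.log_le_log (pow_sum_exp_le_Zn hC hn w hw h0 h1 hinj (N + 1))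
  rw [← hs, ENNReal.log_ofReal_of_pos (by positivity), Real.log_pow] at hZ
  refine absurd hlt (not_lt.2 ?_)
  rw [← EReal.coe_inv]
  refine le_trans (le_of_eq ?_) (mul_le_mul_of_nonneg_left hZ ?_)
  · rw [← EReal.coe_mul]
    congr 1
    push_cast
    field_simp
  · exact_mod_cast inv_nonneg.2 (Nat.cast_nonneg _)

lemma birkhoff_le_of_return {M : ℕ → ℕ → Prop} {φ : Pt → ℝ} {C : ℝ} (hC0 : 0 ≤ C)
    (hC : BoundedDistortion M φ C) {a : ℕ} (hP : pressureAt M φ a = 0) {n : ℕ} {x : Pt}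
    (hx : isAdmissible M x) (h0 : x 0 = a) (h1 : x n = a) : birkhoff φ n x ≤ C := by
  rcases n.eq_zero_or_pos with rfl | hn
  · simpa [birkhoff] using hC0
  · have := sum_exp_birkhoff_le hC hP hn (ι := Unit) (fun _ => x) (fun _ => hx) (fun _ => h0)
      (fun _ => h1) (fun _ _ _ => rfl)
    simpa using this

/-- Insertion of the first `l` symbols of `z` at position `i` of `x`. -/
def insertWord (x z : Pt) (l i : ℕ) : Pt := fun j =>
  if j < i then x j else if j < i + l then z (j - i) else x (j - l)

lemma insertWord_of_le {x z : Pt} {l i : ℕ} (hl : 0 < l) (h : x i = z 0) {j : ℕ} (hj : j ≤ i) :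
    insertWord x z l i j = x j := by
  rcases hj.lt_or_eq with hj | rfl
  · simp [insertWord, hj]
  · simp [insertWord, hl, h]

lemma shiftMap_insertWord_apply {x z : Pt} {l i : ℕ} (h : x i = z l) {j : ℕ} (hj : j ≤ l) :
    shiftMap^[i] (insertWord x z l i) j = z j := by
  rw [shiftMap_iterate_apply]
  rcases hj.lt_or_eq with hj | rfl
  · rw [insertWord, if_neg (by omega), if_pos (by omega), Nat.add_sub_cancel]
  · rw [insertWord, if_neg (by omega), if_neg (by omega), Nat.add_sub_cancel_left, h]

lemma shiftMap_insertWord (x z : Pt) (l i : ℕ) :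
    shiftMap^[i + l] (insertWord x z l i) = shiftMap^[i] x := by
  funext j
  rw [shiftMap_iterate_apply, shiftMap_iterate_apply, insertWord, if_neg (by omega),
    if_neg (by omega)]
  congr 1
  omega

lemma isAdmissible_insertWord {M : ℕ → ℕ → Prop} {x z : Pt} {l i : ℕ} (hl : 0 < l)
    (hx : isAdmissible M x) (hz : isAdmissible M z) (h0 : x i = z 0) (h1 : x i = z l) :
    isAdmissible M (insertWord x z l i) := by
  intro j
  rcases lt_or_ge j i with hj | hj
  · rw [insertWord_of_le hl h0 hj.le, insertWord_of_le hl h0 hj]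
    exact hx j
  obtain ⟨k, rfl⟩ := Nat.exists_eq_add_of_le hj
  rcases lt_or_ge k l with hk | hk
  · have e1 := shiftMap_insertWord_apply h1 hk.le
    have e2 := shiftMap_insertWord_apply h1 hk
    rw [shiftMap_iterate_apply] at e1 e2
    rw [show i + k = k + i by ring, show k + i + 1 = k + 1 + i by ring, e1, e2]
    exact hz k
  · rw [insertWord, insertWord, if_neg (by omega), if_neg (by omega), if_neg (by omega),
      if_neg (by omega), show i + k + 1 - l = i + k - l + 1 by omega]
    exact hx _

lemma exists_return_through {M : ℕ → ℕ → Prop} (htrans : TopTransitive M) {a b : ℕ}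
    (hab : a ≠ b) : ∃ (z : Pt) (l β : ℕ), isAdmissible M z ∧ z 0 = a ∧ z l = a ∧ β < l ∧
      z β = b ∧ ∀ j < β, z j ≠ b := by
  obtain ⟨m, u, hu, hu0, hum⟩ := htrans a b
  obtain ⟨n, v, hv, hv0, hvn⟩ := htrans b a
  have hn : 0 < n := Nat.pos_of_ne_zero fun h => hab (by rw [← hvn, h, hv0])
  let z : Pt := fun j => if j < m then u j else v (j - m)
  have hzb : z m = b := by simp [z, hv0]
  have hex : ∃ j, z j = b := ⟨m, hzb⟩
  refine ⟨z, m + n, Nat.find hex, fun j => ?_, ?_, ?_, ?_, Nat.find_spec hex,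
    fun j hj => Nat.find_min hex hj⟩
  · simp only [z]
    rcases lt_trichotomy (j + 1) m with hj | hj | hj
    · rw [if_pos (by omega), if_pos hj]
      exact hu j
    · rw [if_pos (by omega), if_neg (by omega), hj, Nat.sub_self, hv0, ← hum, ← hj]
      exact hu j
    · rw [if_neg (by omega), if_neg (by omega), show j + 1 - m = j - m + 1 by omega]
      exact hv _
  · have hm : 0 < m := Nat.pos_of_ne_zero fun h => hab (by rw [← hu0, ← hum, h])
    simp [z, hm, hu0]
  · simp [z, hvn]
  · exact (Nat.find_min' hex hzb).trans_lt (by omega)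

/-- Number of visits to the state `a` at times in `[0, n)`. -/
def visits (a n : ℕ) (x : Pt) : ℕ := Nat.count (fun i => x i = a) n

lemma visits_add (a m n : ℕ) (x : Pt) :
    visits a (m + n) x = visits a m x + visits a n (shiftMap^[m] x) := by
  simp only [visits, Nat.count_add, shiftMap_iterate_apply, add_comm]

/-- Return words at `a` which visit `a` often and avoid `b` carry small weight. -/
lemma visits_mul_exp_birkhoff_le {M : ℕ → ℕ → Prop} {φ : Pt → ℝ} {C : ℝ}
    (hC : BoundedDistortion M φ C) {a b : ℕ} (hP : pressureAt M φ a = 0)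
    {z : Pt} {l β : ℕ} (hz : isAdmissible M z) (hz0 : z 0 = a) (hzl : z l = a) (hβ : β < l)
    (hzb : z β = b) (hzβ : ∀ j < β, z j ≠ b) {n : ℕ} {x : Pt}
    (hx : isAdmissible M x) (h0 : x 0 = a) (h1 : x n = a) (hb : visits b n x = 0) :
    visits a n x * exp (birkhoff φ n x + birkhoff φ l z - 2 * C) ≤ exp C := by
  have hl : 0 < l := by omega
  let ι := {i // i ∈ (Finset.range n).filter fun i => x i = a}
  have hmem (i : ι) : i.1 < n ∧ x i.1 = a :=
    let h := Finset.mem_filter.1 i.2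
    ⟨Finset.mem_range.1 h.1, h.2⟩
  have hbx : ∀ j < n, x j ≠ b := by
    simpa [visits, Nat.count_eq_card_filter_range, Finset.filter_eq_empty_iff] using hb
  have hzx0 (i : ι) : x i.1 = z 0 := (hmem i).2.trans hz0.symm
  have hzxl (i : ι) : x i.1 = z l := (hmem i).2.trans hzl.symm
  have hadm (i : ι) := isAdmissible_insertWord hl hx hz (hzx0 i) (hzxl i)
  have hfirst (i : ι) : ∀ j < i.1 + β, insertWord x z l i.1 j ≠ b := by
    intro j hj
    have := hmem i
    rcases lt_or_ge j i.1 with hj' | hj'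
    · rw [insertWord, if_pos hj']
      exact hbx j (by omega)
    · rw [insertWord, if_neg (by omega), if_pos (by omega)]
      exact hzβ _ (by omega)
  have hhit (i : ι) : insertWord x z l i.1 (i.1 + β) = b := by
    rw [insertWord, if_neg (by omega), if_pos (by omega), Nat.add_sub_cancel_left, hzb]
  have hsum := sum_exp_birkhoff_le hC hP (n := n + l) (by omega) (ι := ι)
    (fun i => insertWord x z l i.1) hadm
    (fun i => by rw [insertWord_of_le hl (hzx0 i) (Nat.zero_le _), h0])
    (fun i => by
      have := hmem i
      rw [insertWord, if_neg (by omega), if_neg (by omega), Nat.add_sub_cancel, h1])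
    (fun i j hij => by
      have hi := hmem i
      have hj := hmem j
      rcases lt_trichotomy i.1 j.1 with h | h | h
      · exact absurd ((hij (i.1 + β) (by omega)).symm.trans (hhit i)) (hfirst j _ (by omega))
      · exact Subtype.ext h
      · exact absurd ((hij (j.1 + β) (by omega)).trans (hhit j)) (hfirst i _ (by omega)))
  refine le_trans ?_ hsum
  have hcard : visits a n x = Fintype.card ι := by
    simp [ι, visits, Nat.count_eq_card_filter_range]
  rw [hcard, ← nsmul_eq_mul, ← Finset.card_univ, ← Finset.sum_const]
  refine Finset.sum_le_sum fun i _ => Real.exp_le_exp.2 ?_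
  have hi := hmem i
  obtain ⟨m, hm⟩ := Nat.exists_eq_add_of_le hi.1.le
  have ex := birkhoff_add φ i.1 m x
  have ey := birkhoff_add φ (i.1 + l) m (insertWord x z l i.1)
  rw [← hm] at ex
  rw [shiftMap_insertWord, birkhoff_add φ i.1 l, add_right_comm i.1 l m, ← hm] at ey
  have e1 := hC i.1 x _ hx (hadm i) fun j hj => (insertWord_of_le hl (hzx0 i) hj).symm
  have e2 := hC l z _ hz ((hadm i).shift i.1)
    fun j hj => (shiftMap_insertWord_apply (hzxl i) hj).symm
  linarith

lemma exists_visits_eq {a n L : ℕ} {x : Pt} (h : L < visits a n x) :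
    ∃ m < n, x m = a ∧ visits a m x = L := by
  have hf (hf : (Set.ofPred fun i => x i = a).Finite) : L < hf.toFinset.card :=
    h.trans_le (Nat.count_le_card hf n)
  exact ⟨_, Nat.nth_lt_of_lt_count h, Nat.nth_mem _ hf, Nat.count_nth hf⟩

lemma visits_le_of_return {M : ℕ → ℕ → Prop} {φ : Pt → ℝ} {C : ℝ} {a b L : ℕ} (hL : 0 < L)
    (hup : ∀ (n : ℕ) (x : Pt), isAdmissible M x → x 0 = a → x n = a → birkhoff φ n x ≤ C)
    (hdown : ∀ (n : ℕ) (x : Pt), isAdmissible M x → x 0 = a → x n = a → visits b n x = 0 →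
      visits a n x = L → birkhoff φ n x ≤ -1)
    (hC0 : 0 ≤ C) (n : ℕ) (x : Pt) (hx : isAdmissible M x) (h0 : x 0 = a) (h1 : x n = a) :
    (visits a n x : ℝ) ≤ L * ((C + 1) * visits b n x - birkhoff φ n x + (C + 1)) := by
  induction n using Nat.strong_induction_on generalizing x with
  | _ n ih =>
  have hL' : (0 : ℝ) < L := by exact_mod_cast hL
  rcases le_or_gt (visits a n x) L with hle | hlt
  · have hle' : (visits a n x : ℝ) ≤ L := by exact_mod_cast hle
    have hS := hup n x hx h0 h1
    have : 0 ≤ (C + 1) * visits b n x := by positivity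
    nlinarith
  · obtain ⟨m, hmn, hm, hcount⟩ := exists_visits_eq hlt
    have hm0 : m ≠ 0 := by
      rintro rfl
      simp [visits] at hcount
      omega
    obtain ⟨r, rfl⟩ := Nat.exists_eq_add_of_le hmn.le
    have hrest := ih r (by omega) (shiftMap^[m] x) (hx.shift m)
      (by rw [shiftMap_iterate_apply, zero_add, hm])
      (by rw [shiftMap_iterate_apply, add_comm, h1])
    have hhead : birkhoff φ m x + 1 ≤ (C + 1) * visits b m x := by
      rcases (visits b m x).eq_zero_or_pos with hb | hb
      · have := hdown m x hx h0 hm hb hcount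
        rw [hb]
        push_cast
        linarith
      · have h1' : (1 : ℝ) ≤ visits b m x := by exact_mod_cast hb
        have := hup m x hx h0 hm
        nlinarith
    rw [visits_add, visits_add, birkhoff_add, hcount]
    push_cast
    nlinarith [mul_le_mul_of_nonneg_left hhead hL'.le]

lemma visits_mul_of_periodic (a : ℕ) {p : ℕ} {x : Pt} (hx : shiftMap^[p] x = x) (j : ℕ) :
    visits a (j * p) x = j * visits a p x := by
  induction j with
  | zero => simp [visits]
  | succ j ih => rw [add_mul, one_mul, add_comm, visits_add, hx, ih, add_mul, one_mul, add_comm]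

/-- Along periodic orbits, visits to `a` are controlled by visits to `b` and by the loss in the
Birkhoff sum. -/
lemma exists_visits_le {M : ℕ → ℕ → Prop} {φ : Pt → ℝ} (htrans : TopTransitive M)
    (hsum : SummableVariations M φ) {a b : ℕ} (hP : pressureAt M φ a = 0) (hab : a ≠ b) :
    ∃ D : ℝ, 0 ≤ D ∧ ∀ (p : ℕ) (x : Pt), isAdmissible M x → shiftMap^[p] x = x →
      (visits a p x : ℝ) ≤ D * (visits b p x + |birkhoff φ p x|) := by
  obtain ⟨C, hC0, hC⟩ := hsum.exists_boundedDistortion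
  obtain ⟨z, l, β, hz, hz0, hzl, hβ, hzb, hzβ⟩ := exists_return_through htrans hab
  set K := 3 * C - birkhoff φ l z + 1 with hK
  obtain ⟨L, hLK⟩ := exists_nat_gt (exp K)
  have hL' : (0 : ℝ) < L := (exp_pos _).trans hLK
  have hL : 0 < L := by exact_mod_cast hL'
  have hdown (n : ℕ) (x : Pt) (hx : isAdmissible M x) (h0 : x 0 = a) (h1 : x n = a)
      (hb : visits b n x = 0) (ha : visits a n x = L) : birkhoff φ n x ≤ -1 := by
    have h := visits_mul_exp_birkhoff_le hC hP hz hz0 hzl hβ hzb hzβ hx h0 h1 hb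
    rw [ha] at h
    have h' := (mul_le_mul_of_nonneg_right hLK.le (exp_pos _).le).trans h
    rw [← Real.exp_add, Real.exp_le_exp] at h'
    linarith
  have hbound := visits_le_of_return hL
    (fun n x hx h0 h1 => birkhoff_le_of_return hC0 hC hP hx h0 h1) hdown hC0
  refine ⟨L * (C + 1), by positivity, fun p x hx hp => ?_⟩
  by_cases ha : ∃ i, x i = a
  swap
  · have : visits a p x = 0 := by
      simp [visits, Nat.count_eq_card_filter_range, not_exists.1 ha]
    rw [this, Nat.cast_zero]
    positivity
  obtain ⟨i, hi⟩ := ha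
  set y := shiftMap^[i] x with hy
  have hyp : shiftMap^[p] y = y := by
    rw [hy, ← Function.iterate_add_apply, add_comm, Function.iterate_add_apply, hp]
  have hv (c : ℕ) : visits c p y = visits c p x := by
    have h1 := visits_add c i p x
    have h2 := visits_add c p i x
    rw [hp, add_comm p i] at h2
    rw [← hy] at h1
    omega
  have hS : birkhoff φ p y = birkhoff φ p x := by
    have h1 := birkhoff_add φ i p x
    have h2 := birkhoff_add φ p i x
    rw [hp, add_comm p i] at h2
    rw [← hy] at h1
    linarith
  have hy0 : y 0 = a := by rw [hy, shiftMap_iterate_apply, zero_add, hi]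
  have hall (j : ℕ) : (j : ℝ) * (visits a p x - L * ((C + 1) * visits b p x - birkhoff φ p x))
      ≤ L * (C + 1) := by
    have hjp : shiftMap^[j * p] y = y := by
      rw [mul_comm, Function.iterate_mul, Function.iterate_fixed hyp]
    have h := hbound (j * p) y (hx.shift i) hy0
      (by rw [← hy0, ← zero_add (j * p), ← shiftMap_iterate_apply _ y, hjp])
    rw [visits_mul_of_periodic a hyp, visits_mul_of_periodic b hyp,
      birkhoff_mul_of_periodic φ hyp, hv, hv, hS] at h
    push_cast at h
    linarith
  have hnonpos : (visits a p x : ℝ) - L * ((C + 1) * visits b p x - birkhoff φ p x) ≤ 0 := by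
    by_contra! hpos
    obtain ⟨j, hj⟩ := Archimedean.arch (L * (C + 1) + 1) hpos
    rw [nsmul_eq_mul] at hj
    linarith [hall j]
  have h1 : -birkhoff φ p x ≤ (C + 1) * |birkhoff φ p x| := by
    nlinarith [neg_abs_le (birkhoff φ p x), abs_nonneg (birkhoff φ p x)]
  nlinarith [mul_le_mul_of_nonneg_left h1 hL'.le]

lemma card_filter_le_eq_sum_visits (q p : ℕ) (x : Pt) :
    ((Finset.range p).filter fun i => x i ≤ q).card
      = ∑ a ∈ Finset.range (q + 1), visits a p x := by
  rw [Finset.card_eq_sum_card_fiberwise (f := x) (t := Finset.range (q + 1))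
    (fun i hi => by simpa [Nat.lt_succ_iff] using (Finset.mem_filter.1 hi).2)]
  refine Finset.sum_congr rfl fun a ha => ?_
  rw [visits, Nat.count_eq_card_filter_range, Finset.filter_filter]
  congr 1
  refine Finset.filter_congr fun i _ => ?_
  rw [Finset.mem_range] at ha
  constructor
  · exact fun h => h.2
  · exact fun h => ⟨by omega, h⟩

lemma card_filter_le_add_visits_le (q p : ℕ) (x : Pt) :
    ((Finset.range p).filter fun i => x i ≤ q).card + visits (q + 1) p x ≤ p := by
  have h := card_filter_le_eq_sum_visits (q + 1) p x
  rw [Finset.sum_range_succ, ← card_filter_le_eq_sum_visits] at h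
  rw [← h]
  exact (Finset.card_filter_le _ _).trans_eq (Finset.card_range p)

end CMS

/-- Lemma `lem:noeq`.
For a topologically transitive countable Markov shift with the F-property and a
potential `φ` with summable variations and Gurevich pressure `P(φ) = 0`:
there is no `q ∈ ℕ` and sequence `x^k` of periodic points of periods `p_k ≥ 1`
such that `(1/p_k) S_{p_k} φ(x^k) → 0` and `ν_k([≤ q]) → 1` as `k → ∞`, where
`ν_k = (1/p_k) ∑_{i<p_k} δ_{σ^i x^k}`, so that
`ν_k([≤ q]) = #{0 ≤ i < p_k : x^k_i ≤ q} / p_k`. -/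
theorem no_escaping_periodic_sequence
    (M : ℕ → ℕ → Prop) (φ : Pt → ℝ)
    (htrans : TopTransitive M) (hF : FProperty M)
    (hsum : SummableVariations M φ)
    (hP : ∀ a : ℕ, pressureAt M φ a = (0 : EReal)) :
    ¬ ∃ (q : ℕ) (x : ℕ → Pt) (p : ℕ → ℕ),
      (∀ k : ℕ, 0 < p k ∧ isAdmissible M (x k) ∧ shiftMap^[p k] (x k) = x k) ∧
      Tendsto (fun k : ℕ => birkhoff φ (p k) (x k) / (p k : ℝ)) atTop (nhds 0) ∧
      Tendsto (fun k : ℕ =>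
        ((((Finset.range (p k)).filter (fun i => x k i ≤ q)).card : ℝ) / (p k : ℝ)))
        atTop (nhds 1) := by
  rintro ⟨q, x, p, hx, hS, hcard⟩
  have hex (a : ℕ) : ∃ D : ℝ, 0 ≤ D ∧ (a < q + 1 → ∀ (p : ℕ) (x : Pt), isAdmissible M x →
      shiftMap^[p] x = x →
      (visits a p x : ℝ) ≤ D * (visits (q + 1) p x + |birkhoff φ p x|)) := by
    by_cases ha : a < q + 1
    · obtain ⟨D, hD, h⟩ := exists_visits_le htrans hsum (hP a) ha.ne
      exact ⟨D, hD, fun _ => h⟩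
    · exact ⟨0, le_rfl, fun h => absurd h ha⟩
  choose D hD0 hD using hex
  set E := ∑ a ∈ Finset.range (q + 1), D a
  have hE : 0 ≤ E := Finset.sum_nonneg fun a _ => hD0 a
  have hlim := ((tendsto_const_nhds (x := (1 : ℝ))).sub hcard).add hS.abs |>.const_mul E
  rw [sub_self, abs_zero, add_zero, mul_zero] at hlim
  refine absurd (le_of_tendsto_of_tendsto' hcard hlim fun k => ?_) (by norm_num)
  obtain ⟨hp, hadm, hper⟩ := hx k
  have hp' : (0 : ℝ) < p k := by exact_mod_cast hp
  have hb : ((((Finset.range (p k)).filter (fun i => x k i ≤ q)).card : ℝ)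
      + visits (q + 1) (p k) (x k)) ≤ p k := by
    exact_mod_cast card_filter_le_add_visits_le q (p k) (x k)
  have hmain : (((Finset.range (p k)).filter (fun i => x k i ≤ q)).card : ℝ)
      ≤ E * (visits (q + 1) (p k) (x k) + |birkhoff φ (p k) (x k)|) := by
    rw [card_filter_le_eq_sum_visits, Nat.cast_sum, Finset.sum_mul]
    exact Finset.sum_le_sum fun a ha => hD a (Finset.mem_range.1 ha) _ _ hadm hper
  rw [abs_div, abs_of_pos hp', one_sub_div hp'.ne', ← add_div, mul_div_assoc']
  gcongr
  refine hmain.trans ?_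
  gcongr
  linarith
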